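/- Let q be prime and δ > 0. There exists ε(δ) > 0 depending only on δ and q such that for every q-ary input channel W with I(W) ∈ (δ, 1−δ), the polar transform satisfies I(W⁻) + ε(δ) ≤ I(W) ≤ I(W⁺) − ε(δ). -/

import Mathlib

/-- Uniform-input (symmetric) mutual information of a channel `W : ℤ/qℤ → Y`,
measured in base `q`. -/
noncomputable def mutInfo (q : ℕ) [NeZero q] {Y : Type*} [Fintype Y] (W : ZMod q → Y → ℝ) : ℝ :=
  ∑ x, ∑ y, (1 / q : ℝ) * W x y *
    Real.logb q (W x y / ((1 / q : ℝ) * ∑ x', W x' y))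

/-- `W` is a channel: each row is a probability distribution on the output. -/
def IsChannel (q : ℕ) [NeZero q] {Y : Type*} [Fintype Y] (W : ZMod q → Y → ℝ) : Prop :=
  (∀ x y, 0 ≤ W x y) ∧ ∀ x, ∑ y, W x y = 1

/-- The "minus" polar transform `W⁻(y₁,y₂|u₁) = (1/q)∑_{u₂} W(y₁|u₁−u₂)W(y₂|u₂)`. -/
noncomputable def polarMinus (q : ℕ) [NeZero q] {Y : Type*} [Fintype Y]
    (W : ZMod q → Y → ℝ) : ZMod q → Y × Y → ℝ :=
  fun u1 yy => (1 / q : ℝ) * ∑ u2, W (u1 - u2) yy.1 * W u2 yy.2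

/-- The "plus" polar transform `W⁺(y₁,y₂,u₁|u₂) = (1/q)W(y₁|u₁−u₂)W(y₂|u₂)`. -/
noncomputable def polarPlus (q : ℕ) [NeZero q] {Y : Type*} [Fintype Y]
    (W : ZMod q → Y → ℝ) : ZMod q → Y × Y × ZMod q → ℝ :=
  fun u2 z => (1 / q : ℝ) * W (z.2.2 - u2) z.1 * W u2 z.2.1

/-- Shannon entropy (in nats) of a vector indexed by `ZMod q`. -/
noncomputable def entropy (q : ℕ) [NeZero q] (p : ZMod q → ℝ) : ℝ :=
  ∑ x, Real.negMulLog (p x)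

/-- Additive convolution on `ZMod q`. -/
def cyclicConv (q : ℕ) [NeZero q] (p r : ZMod q → ℝ) : ZMod q → ℝ :=
  fun u => ∑ v, p (u - v) * r v

theorem continuous_entropy (q : ℕ) [NeZero q] : Continuous (entropy q) := by
  unfold entropy
  exact continuous_finsetSum _ fun x _ => Real.continuous_negMulLog.comp (continuous_apply x)

theorem sum_cyclicConv (q : ℕ) [NeZero q] (p r : ZMod q → ℝ) :
    ∑ u, cyclicConv q p r u = (∑ x, p x) * ∑ x, r x := by
  unfold cyclicConv
  rw [Finset.sum_comm, Finset.mul_sum]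
  refine Finset.sum_congr rfl fun v _ => ?_
  rw [← Finset.sum_mul]
  congr 1
  exact Equiv.sum_comp (Equiv.subRight v) p

theorem cyclicConv_mem_stdSimplex (q : ℕ) [NeZero q] {p r : ZMod q → ℝ}
    (hp : p ∈ stdSimplex ℝ (ZMod q)) (hr : r ∈ stdSimplex ℝ (ZMod q)) :
    cyclicConv q p r ∈ stdSimplex ℝ (ZMod q) :=
  ⟨fun _ => Finset.sum_nonneg fun _ _ => mul_nonneg (hp.1 _) (hr.1 _),
    by rw [sum_cyclicConv, hp.2, hr.2, one_mul]⟩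

theorem entropy_nonneg (q : ℕ) [NeZero q] {p : ZMod q → ℝ}
    (hp : p ∈ stdSimplex ℝ (ZMod q)) : 0 ≤ entropy q p :=
  Finset.sum_nonneg fun x _ => Real.negMulLog_nonneg (hp.1 x)
    (hp.2 ▸ Finset.single_le_sum (fun i _ => hp.1 i) (Finset.mem_univ x))

theorem entropy_le_log (q : ℕ) [NeZero q] {p : ZMod q → ℝ}
    (hp : p ∈ stdSimplex ℝ (ZMod q)) : entropy q p ≤ Real.log q := by
  have hq0 : (0 : ℝ) < q := by exact_mod_cast Nat.pos_of_ne_zero (NeZero.ne q)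
  have h := Real.concaveOn_negMulLog.le_map_sum (t := Finset.univ) (w := fun _ : ZMod q => (q : ℝ)⁻¹)
    (p := p) (fun _ _ => by positivity) (by simp [ZMod.card, hq0.ne']) (fun i _ => hp.1 i)
  simp only [smul_eq_mul, ← Finset.mul_sum, hp.2, mul_one] at h
  rw [Real.negMulLog, Real.log_inv, neg_mul_neg] at h
  exact le_of_mul_le_mul_left h (inv_pos.2 hq0)

theorem sum_mul_negMulLog_shift (q : ℕ) [NeZero q] {p r : ZMod q → ℝ} (hr : ∑ x, r x = 1) :
    ∑ u, ∑ v, r v * Real.negMulLog (p (u - v)) = entropy q p := by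
  rw [Finset.sum_comm]
  have (v : ZMod q) : ∑ u, r v * Real.negMulLog (p (u - v)) = r v * entropy q p := by
    rw [← Finset.mul_sum]
    congr 1
    exact Equiv.sum_comp (Equiv.subRight v) fun x => Real.negMulLog (p x)
  simp_rw [this]
  rw [← Finset.sum_mul, hr, one_mul]

theorem sum_mul_negMulLog_le (q : ℕ) [NeZero q] {p r : ZMod q → ℝ}
    (hp : p ∈ stdSimplex ℝ (ZMod q)) (hr : r ∈ stdSimplex ℝ (ZMod q)) (u : ZMod q) :
    ∑ v, r v * Real.negMulLog (p (u - v)) ≤ Real.negMulLog (cyclicConv q p r u) := by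
  have h := Real.concaveOn_negMulLog.le_map_sum (t := Finset.univ) (w := r)
    (p := fun v => p (u - v)) (fun i _ => hr.1 i) hr.2 (fun i _ => hp.1 _)
  simpa only [smul_eq_mul, cyclicConv, mul_comm (r _) (p _)] using h

theorem entropy_le_entropy_cyclicConv (q : ℕ) [NeZero q] {p r : ZMod q → ℝ}
    (hp : p ∈ stdSimplex ℝ (ZMod q)) (hr : r ∈ stdSimplex ℝ (ZMod q)) :
    entropy q p ≤ entropy q (cyclicConv q p r) := by
  rw [← sum_mul_negMulLog_shift q hr.2]
  exact Finset.sum_le_sum fun u _ => sum_mul_negMulLog_le q hp hr u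

theorem exists_ne_support_of_entropy_pos (q : ℕ) [NeZero q] {r : ZMod q → ℝ}
    (hr : r ∈ stdSimplex ℝ (ZMod q)) (h : 0 < entropy q r) :
    ∃ a b, a ≠ b ∧ r a ≠ 0 ∧ r b ≠ 0 := by
  by_contra! hc
  refine h.ne' (Finset.sum_eq_zero fun a _ => ?_)
  by_cases ha : r a = 0
  · simp [ha]
  · have : r a = 1 := by
      rw [← hr.2]
      exact (Finset.sum_eq_single a (fun b _ hb => hc a b hb.symm ha) (by simp)).symm
    simp [this]

theorem eq_const_of_periodic (q : ℕ) [NeZero q] (hq : q.Prime) {p : ZMod q → ℝ} {d : ZMod q}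
    (hd : d ≠ 0) (h : ∀ x, p (x + d) = p x) (x : ZMod q) : p x = p 0 := by
  have := Fact.mk hq
  have key (n : ℕ) : p (n * d) = p 0 := by
    induction n with
    | zero => simp
    | succ n ih => rw [Nat.cast_succ, add_mul, one_mul, h, ih]
  have := key (x / d).val
  rwa [ZMod.natCast_zmod_val, div_mul_cancel₀ _ hd] at this

theorem entropy_eq_log_of_const (q : ℕ) [NeZero q] {p : ZMod q → ℝ}
    (hp : p ∈ stdSimplex ℝ (ZMod q)) (h : ∀ x, p x = p 0) : entropy q p = Real.log q := by
  have hq0 : (q : ℝ) ≠ 0 := by exact_mod_cast NeZero.ne q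
  have h1 : (q : ℝ) * p 0 = 1 := by
    rw [← hp.2, Finset.sum_congr rfl fun x _ => h x]
    simp [ZMod.card]
  have h2 : p 0 = (q : ℝ)⁻¹ := eq_inv_of_mul_eq_one_right h1
  unfold entropy
  rw [Finset.sum_congr rfl fun x _ => by rw [h x, h2]]
  simp [ZMod.card, Real.negMulLog, hq0]

theorem entropy_lt_entropy_cyclicConv (q : ℕ) [NeZero q] (hq : q.Prime) {p r : ZMod q → ℝ}
    (hp : p ∈ stdSimplex ℝ (ZMod q)) (hr : r ∈ stdSimplex ℝ (ZMod q))
    (hpu : entropy q p < Real.log q) (hrd : 0 < entropy q r) :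
    entropy q p < entropy q (cyclicConv q p r) := by
  refine lt_of_le_of_ne (entropy_le_entropy_cyclicConv q hp hr) fun heq => hpu.ne ?_
  obtain ⟨a, b, hab, ha, hb⟩ := exists_ne_support_of_entropy_pos q hr hrd
  rw [← sum_mul_negMulLog_shift q hr.2] at heq
  have hu := (Finset.sum_eq_sum_iff_of_le
    fun u _ => sum_mul_negMulLog_le q hp hr u).1 heq
  have hcoord (u v : ZMod q) (hv : r v ≠ 0) : p (u - v) = cyclicConv q p r u := by
    have h := (Real.strictConcaveOn_negMulLog.map_sum_eq_iff' (t := Finset.univ) (w := r)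
      (p := fun v => p (u - v)) (fun i _ => hr.1 i) hr.2 (fun i _ => hp.1 _)).1
    simp only [smul_eq_mul, mul_comm (r _) (p _)] at h
    exact h (by simpa only [cyclicConv, mul_comm (r _)] using (hu u (Finset.mem_univ u)).symm)
      v (Finset.mem_univ v) hv
  refine entropy_eq_log_of_const q hp (eq_const_of_periodic q hq (sub_ne_zero.2 hab) fun x => ?_)
  have h1 := hcoord (x + a) a ha
  have h2 := hcoord (x + a) b hb
  rw [add_sub_cancel_right] at h1
  rw [← add_sub_assoc, h1, h2]

/-- The entropy gain of a convolution is bounded below, uniformly over pairs of distributions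
the first of which is far from uniform and the second far from deterministic. -/
theorem exists_entropy_gain (q : ℕ) [NeZero q] (hq : q.Prime) {η : ℝ} (hη : 0 < η) :
    ∃ c > 0, ∀ p ∈ stdSimplex ℝ (ZMod q), ∀ r ∈ stdSimplex ℝ (ZMod q),
      entropy q p ≤ Real.log q - η → η ≤ entropy q r →
      c ≤ entropy q (cyclicConv q p r) - entropy q p := by
  have hcE := continuous_entropy q
  have hcC : Continuous fun z : (ZMod q → ℝ) × (ZMod q → ℝ) => cyclicConv q z.1 z.2 := by
    unfold cyclicConv
    fun_prop
  have hcF : Continuous fun z : (ZMod q → ℝ) × (ZMod q → ℝ) =>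
      entropy q (cyclicConv q z.1 z.2) - entropy q z.1 :=
    (hcE.comp hcC).sub (hcE.comp continuous_fst)
  have hclosed : IsClosed {z : (ZMod q → ℝ) × (ZMod q → ℝ) |
      entropy q z.1 ≤ Real.log q - η ∧ η ≤ entropy q z.2} :=
    (isClosed_le (hcE.comp continuous_fst) continuous_const).inter
      (isClosed_le continuous_const (hcE.comp continuous_snd))
  have hK := ((isCompact_stdSimplex ℝ (ZMod q)).prod
    (isCompact_stdSimplex ℝ (ZMod q))).inter_right hclosed
  obtain ⟨c, hc, h⟩ := hK.exists_forall_le' hcF.continuousOn (a := 0) (by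
    rintro ⟨p, r⟩ ⟨⟨hp, hr⟩, h1, h2⟩
    have h1' : entropy q p < Real.log q := by
      have : entropy q p ≤ Real.log q - η := h1
      linarith
    exact sub_pos.2 (entropy_lt_entropy_cyclicConv q hq hp hr h1' (hη.trans_le h2)))
  refine ⟨c, hc, fun p hp r hr h1 h2 => ?_⟩
  have hz : (p, r) ∈ stdSimplex ℝ (ZMod q) ×ˢ stdSimplex ℝ (ZMod q) := Set.mk_mem_prod hp hr
  exact h (p, r) (Set.mem_inter hz (And.intro h1 h2))

theorem mutInfo_mul_eq (q : ℕ) [NeZero q] (hq : 1 < q) {Y : Type*} [Fintype Y]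
    {W : ZMod q → Y → ℝ} (hW : ∀ x y, 0 ≤ W x y) :
    mutInfo q W * (q * Real.log q) =
      ∑ y, ((∑ x, W x y) * Real.log q - ∑ x, Real.negMulLog (W x y) +
        Real.negMulLog (∑ x, W x y)) := by
  have hq0 : (q : ℝ) ≠ 0 := by exact_mod_cast NeZero.ne q
  have hL : Real.log q ≠ 0 := (Real.log_pos (by exact_mod_cast hq)).ne'
  unfold mutInfo
  rw [Finset.sum_comm, Finset.sum_mul]
  refine Finset.sum_congr rfl fun y _ => ?_
  have hterm (x : ZMod q) : (1 / q : ℝ) * W x y *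
      Real.logb q (W x y / ((1 / q : ℝ) * ∑ x', W x' y)) * (q * Real.log q) =
      W x y * Real.log q - Real.negMulLog (W x y) - W x y * Real.log (∑ x', W x' y) := by
    by_cases h0 : W x y = 0
    · simp [h0]
    have hs : (∑ x', W x' y) ≠ 0 := fun hs =>
      h0 ((Finset.sum_eq_zero_iff_of_nonneg fun i _ => hW i y).1 hs x (Finset.mem_univ x))
    rw [Real.logb, Real.log_div h0 (by positivity), Real.log_mul (by positivity) hs, one_div,
      Real.log_inv, Real.negMulLog]
    field_simp
    ring
  rw [Finset.sum_mul, Finset.sum_congr rfl fun x _ => hterm x, Finset.sum_sub_distrib,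
    Finset.sum_sub_distrib, ← Finset.sum_mul, ← Finset.sum_mul]
  unfold Real.negMulLog
  ring

theorem mutInfo_mul_eq_of_posterior (q : ℕ) [NeZero q] (hq : 1 < q) {Y : Type*} [Fintype Y]
    {W : ZMod q → Y → ℝ} {s : Y → ℝ} {p : Y → ZMod q → ℝ} (hs : ∀ y, 0 ≤ s y)
    (hp : ∀ y, p y ∈ stdSimplex ℝ (ZMod q)) (hW : ∀ x y, W x y = s y * p y x) :
    mutInfo q W * (q * Real.log q) = ∑ y, s y * (Real.log q - entropy q (p y)) := by
  rw [mutInfo_mul_eq q hq fun x y => by rw [hW]; exact mul_nonneg (hs y) ((hp y).1 x)]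
  refine Finset.sum_congr rfl fun y _ => ?_
  simp_rw [hW, Real.negMulLog_mul]
  rw [Finset.sum_add_distrib, ← Finset.mul_sum, ← Finset.mul_sum, ← Finset.sum_mul, (hp y).2,
    entropy]
  simp only [mul_one]
  ring

theorem exists_posterior (q : ℕ) [NeZero q] {Y : Type*} {W : ZMod q → Y → ℝ}
    (hW : ∀ x y, 0 ≤ W x y) :
    ∃ p : Y → ZMod q → ℝ, (∀ y, p y ∈ stdSimplex ℝ (ZMod q)) ∧
      ∀ x y, W x y = (∑ x', W x' y) * p y x := by
  have (y : Y) : ∃ p ∈ stdSimplex ℝ (ZMod q), ∀ x, W x y = (∑ x', W x' y) * p x := by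
    by_cases hs : (∑ x', W x' y) = 0
    · refine ⟨Pi.single 0 1, single_mem_stdSimplex ℝ 0, fun x => ?_⟩
      rw [hs, zero_mul]
      exact (Finset.sum_eq_zero_iff_of_nonneg fun i _ => hW i y).1 hs x (Finset.mem_univ x)
    · refine ⟨fun x => W x y / ∑ x', W x' y,
        ⟨fun x => div_nonneg (hW x y) (Finset.sum_nonneg fun i _ => hW i y), ?_⟩, fun x => ?_⟩
      · rw [← Finset.sum_div, div_self hs]
      · rw [mul_div_cancel₀ _ hs]
  choose p hp h using this
  exact ⟨p, hp, fun x y => h y x⟩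

theorem sum_shear (q : ℕ) [NeZero q] (f : ZMod q → ZMod q → ℝ) :
    ∑ u, ∑ v, f (u - v) v = ∑ x, ∑ v, f x v := by
  rw [Finset.sum_comm, Finset.sum_comm (f := f)]
  exact Finset.sum_congr rfl fun v _ => Equiv.sum_comp (Equiv.subRight v) fun x => f x v

theorem sum_polarMinus (q : ℕ) [NeZero q] {Y : Type*} [Fintype Y] (W : ZMod q → Y → ℝ)
    (z : Y × Y) :
    ∑ u, polarMinus q W u z = (1 / q : ℝ) * ((∑ x, W x z.1) * ∑ x, W x z.2) := by
  unfold polarMinus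
  rw [← Finset.mul_sum, sum_shear q fun x v => W x z.1 * W v z.2, Fintype.sum_mul_sum]

theorem sum_polarPlus (q : ℕ) [NeZero q] {Y : Type*} [Fintype Y] (W : ZMod q → Y → ℝ)
    (y₁ y₂ : Y) (u : ZMod q) :
    ∑ v, polarPlus q W v (y₁, y₂, u) = polarMinus q W u (y₁, y₂) := by
  simp only [polarPlus, polarMinus, Finset.mul_sum, mul_assoc]

theorem sum_negMulLog_polarPlus (q : ℕ) [NeZero q] {Y : Type*} [Fintype Y]
    (W : ZMod q → Y → ℝ) (y₁ y₂ : Y) :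
    ∑ u, ∑ v, Real.negMulLog (polarPlus q W v (y₁, y₂, u)) =
      (1 / q : ℝ) * ((∑ x, W x y₁) * (∑ x, W x y₂) * Real.log q +
        (∑ x, W x y₂) * (∑ x, Real.negMulLog (W x y₁)) +
        (∑ x, W x y₁) * ∑ x, Real.negMulLog (W x y₂)) := by
  simp only [polarPlus]
  rw [sum_shear q fun x v => Real.negMulLog ((1 / q : ℝ) * W x y₁ * W v y₂)]
  have (x v : ZMod q) : Real.negMulLog ((1 / q : ℝ) * W x y₁ * W v y₂) =
      (1 / q : ℝ) * Real.log q * (W x y₁ * W v y₂) +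
      (1 / q : ℝ) * (Real.negMulLog (W x y₁) * W v y₂) +
      (1 / q : ℝ) * (W x y₁ * Real.negMulLog (W v y₂)) := by
    rw [Real.negMulLog_mul, Real.negMulLog_mul, Real.negMulLog, one_div, Real.log_inv]
    ring
  simp_rw [this, Finset.sum_add_distrib, ← Finset.mul_sum, ← Finset.sum_mul]
  ring

/-- The chain rule: the polar transform preserves total mutual information. -/
theorem mutInfo_polarMinus_add_polarPlus (q : ℕ) [NeZero q] (hq : 1 < q) {Y : Type*} [Fintype Y]
    {W : ZMod q → Y → ℝ} (hW : IsChannel q W) :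
    mutInfo q (polarMinus q W) + mutInfo q (polarPlus q W) = 2 * mutInfo q W := by
  obtain ⟨hW0, hW1⟩ := hW
  have hq0 : (q : ℝ) ≠ 0 := by exact_mod_cast NeZero.ne q
  have hL : Real.log q ≠ 0 := (Real.log_pos (by exact_mod_cast hq)).ne'
  have hmass : ∑ y, ∑ x, W x y = q := by
    rw [Finset.sum_comm, Finset.sum_congr rfl fun x _ => hW1 x]
    simp [ZMod.card]
  have hM : ∀ u z, 0 ≤ polarMinus q W u z := fun u z =>
    mul_nonneg (by positivity) (Finset.sum_nonneg fun _ _ => mul_nonneg (hW0 _ _) (hW0 _ _))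
  have hP : ∀ u z, 0 ≤ polarPlus q W u z := fun u z =>
    mul_nonneg (mul_nonneg (by positivity) (hW0 _ _)) (hW0 _ _)
  refine mul_right_cancel₀ (mul_ne_zero hq0 hL) ?_
  rw [add_mul, mul_assoc, mutInfo_mul_eq q hq hM, mutInfo_mul_eq q hq hP, mutInfo_mul_eq q hq hW0]
  simp_rw [Fintype.sum_prod_type, sum_polarPlus, sum_polarMinus]
  simp_rw [Finset.sum_add_distrib, Finset.sum_sub_distrib, sum_negMulLog_polarPlus,
    ← Finset.sum_mul, sum_polarMinus, Real.negMulLog_mul]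
  have hn : Real.negMulLog (1 / q : ℝ) = (1 / q : ℝ) * Real.log q := by
    rw [Real.negMulLog, one_div, Real.log_inv]; ring
  simp_rw [hn, mul_add, Finset.sum_add_distrib, ← Finset.mul_sum, ← Finset.sum_mul,
    ← Finset.mul_sum, ← Finset.sum_mul, hmass]
  field_simp
  ring

/-- A Markov-type bound: a `[0, 1]`-valued function with mean at least `δ` exceeds `δ / 2`
with probability at least `δ / 2`. -/
theorem half_le_sum_filter {Y : Type*} [Fintype Y] {μ h : Y → ℝ} {δ : ℝ} (hμ : ∀ y, 0 ≤ μ y)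
    (hμ1 : ∑ y, μ y = 1) (hh : ∀ y, h y ≤ 1) (hδ : 0 < δ) (hm : δ ≤ ∑ y, μ y * h y) :
    δ / 2 ≤ ∑ y, μ y * (if δ / 2 ≤ h y then 1 else 0) := by
  have : ∑ y, μ y * h y ≤ ∑ y, (μ y * (if δ / 2 ≤ h y then 1 else 0) + μ y * (δ / 2)) := by
    refine Finset.sum_le_sum fun y _ => ?_
    rw [← mul_add]
    refine mul_le_mul_of_nonneg_left ?_ (hμ y)
    split_ifs with hy
    · linarith [hh y]
    · linarith
  rw [Finset.sum_add_distrib, ← Finset.sum_mul, hμ1] at this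
  linarith

theorem mutInfo_polarMinus_add_le (q : ℕ) [NeZero q] (hq : 1 < q) {δ c : ℝ} (hδ : 0 < δ)
    (hc : 0 < c)
    (hgain : ∀ p ∈ stdSimplex ℝ (ZMod q), ∀ r ∈ stdSimplex ℝ (ZMod q),
      entropy q p ≤ Real.log q - δ / 2 * Real.log q → δ / 2 * Real.log q ≤ entropy q r →
      c ≤ entropy q (cyclicConv q p r) - entropy q p)
    {Y : Type*} [Fintype Y] {W : ZMod q → Y → ℝ} (hW : IsChannel q W)
    (hI : mutInfo q W ∈ Set.Ioo δ (1 - δ)) :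
    mutInfo q (polarMinus q W) + c * (δ / 2) ^ 2 / Real.log q ≤ mutInfo q W := by
  obtain ⟨hW0, hW1⟩ := hW
  have hq0 : (0 : ℝ) < q := by exact_mod_cast Nat.pos_of_ne_zero (NeZero.ne q)
  have hL : 0 < Real.log q := Real.log_pos (by exact_mod_cast hq)
  obtain ⟨p, hp, hWp⟩ := exists_posterior q hW0
  set s : Y → ℝ := fun y => ∑ x, W x y with hs
  have hs0 : ∀ y, 0 ≤ s y := fun y => Finset.sum_nonneg fun x _ => hW0 x y
  have hmass : ∑ y, s y = q := by
    rw [hs, Finset.sum_comm, Finset.sum_congr rfl fun x _ => hW1 x]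
    simp [ZMod.card]
  set μ : Y → ℝ := fun y => s y / q with hμ
  have hμ0 : ∀ y, 0 ≤ μ y := fun y => div_nonneg (hs0 y) hq0.le
  have hμ1 : ∑ y, μ y = 1 := by rw [hμ, ← Finset.sum_div, hmass, div_self hq0.ne']
  have hsμ : ∀ y, s y = q * μ y := fun y => by simp only [hμ]; field_simp
  set h : Y → ℝ := fun y => entropy q (p y) / Real.log q with hh
  have hent : ∀ y, entropy q (p y) = h y * Real.log q := fun y => by
    simp only [hh]; field_simp
  have hh0 : ∀ y, 0 ≤ h y := fun y => div_nonneg (entropy_nonneg q (hp y)) hL.le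
  have hh1 : ∀ y, h y ≤ 1 := fun y => (div_le_one hL).2 (entropy_le_log q (hp y))
  have hIW : mutInfo q W = ∑ y, μ y * (1 - h y) := by
    refine mul_right_cancel₀ (mul_pos hq0 hL).ne' ?_
    rw [mutInfo_mul_eq_of_posterior q hq hs0 hp hWp, Finset.sum_mul]
    refine Finset.sum_congr rfl fun y _ => ?_
    rw [hent, hsμ]
    ring
  have hIM : mutInfo q (polarMinus q W) * Real.log q = ∑ y₁, ∑ y₂, μ y₁ * μ y₂ *
      (Real.log q - entropy q (cyclicConv q (p y₁) (p y₂))) := by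
    have hM := mutInfo_mul_eq_of_posterior q hq (W := polarMinus q W)
      (s := fun z => q * (μ z.1 * μ z.2)) (p := fun z => cyclicConv q (p z.1) (p z.2))
      (fun z => mul_nonneg hq0.le (mul_nonneg (hμ0 _) (hμ0 _)))
      (fun z => cyclicConv_mem_stdSimplex q (hp _) (hp _)) (fun x z => by
        simp only [polarMinus, cyclicConv, Finset.mul_sum]
        refine Finset.sum_congr rfl fun v _ => ?_
        rw [hWp, hWp v]
        change (1 / q : ℝ) * (s z.1 * _ * (s z.2 * _)) = _
        rw [hsμ, hsμ]
        field_simp)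
    refine mul_left_cancel₀ hq0.ne' ?_
    rw [Fintype.sum_prod_type] at hM
    simp only [Finset.mul_sum]
    simp only [mul_assoc] at hM ⊢
    linarith
  have hIW2 : mutInfo q W * Real.log q = ∑ y₁, ∑ y₂, μ y₁ * μ y₂ *
      (Real.log q - entropy q (p y₁)) := by
    rw [hIW, Finset.sum_mul]
    refine Finset.sum_congr rfl fun y _ => ?_
    simp_rw [mul_right_comm (μ y) (μ _)]
    rw [← Finset.mul_sum, hμ1, hent]
    ring
  have hA := half_le_sum_filter hμ0 hμ1 (h := fun y => 1 - h y)
    (fun y => by linarith [hh0 y]) hδ (hIW ▸ hI.1.le)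
  have hB := half_le_sum_filter hμ0 hμ1 hh1 hδ (by
    have h2 := hIW ▸ hI.2
    simp only [mul_sub, Finset.sum_sub_distrib, mul_one, hμ1] at h2
    linarith)
  have hdiff : c * (δ / 2) ^ 2 ≤
      (mutInfo q W - mutInfo q (polarMinus q W)) * Real.log q := by
    rw [sub_mul, hIW2, hIM]
    simp_rw [← Finset.sum_sub_distrib]
    calc c * (δ / 2) ^ 2
        ≤ c * ((∑ y, μ y * (if δ / 2 ≤ 1 - h y then 1 else 0)) *
            ∑ y, μ y * (if δ / 2 ≤ h y then 1 else 0)) := by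
          rw [pow_two]
          gcongr
          exact (half_pos hδ).le.trans hA
      _ ≤ _ := by
          rw [Fintype.sum_mul_sum]
          simp_rw [Finset.mul_sum]
          refine Finset.sum_le_sum fun y₁ _ => Finset.sum_le_sum fun y₂ _ => ?_
          rw [← mul_sub, sub_sub_sub_cancel_left]
          have hm := mul_nonneg (hμ0 y₁) (hμ0 y₂)
          have hle := sub_nonneg.2 (entropy_le_entropy_cyclicConv q (hp y₁) (hp y₂))
          split_ifs with h1 h2
          · have := hgain _ (hp y₁) _ (hp y₂) (by rw [hent]; nlinarith)
              (by rw [hent]; nlinarith)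
            nlinarith
          all_goals simpa using mul_nonneg hm hle
  have := (div_le_iff₀ hL).2 hdiff
  linarith

/-- For prime `q` and `δ > 0` there is `ε(δ) > 0`, depending only on
`δ` and `q` (uniform over all channels and output alphabets), such that every
`q`-ary input channel `W` with `I(W) ∈ (δ, 1−δ)` satisfies
`I(W⁻) + ε(δ) ≤ I(W) ≤ I(W⁺) − ε(δ)`. -/
theorem stmt15 (q : ℕ) [NeZero q] (hq : q.Prime) (δ : ℝ) (hδ : 0 < δ) :
    ∃ ε > 0, ∀ (Y : Type) (_ : Fintype Y) (W : ZMod q → Y → ℝ),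
      IsChannel q W → mutInfo q W ∈ Set.Ioo δ (1 - δ) →
      mutInfo q (polarMinus q W) + ε ≤ mutInfo q W ∧
      mutInfo q W ≤ mutInfo q (polarPlus q W) - ε := by
  have hq1 : 1 < q := hq.one_lt
  have hL : 0 < Real.log q := Real.log_pos (by exact_mod_cast hq1)
  obtain ⟨c, hc, hgain⟩ := exists_entropy_gain q hq (mul_pos (half_pos hδ) hL)
  refine ⟨c * (δ / 2) ^ 2 / Real.log q, by positivity, fun Y _ W hW hI => ?_⟩
  have h1 := mutInfo_polarMinus_add_le q hq1 hδ hc hgain hW hI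
  have h2 := mutInfo_polarMinus_add_polarPlus q hq1 hW
  exact ⟨h1, by linarith⟩
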